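/- Let P1, P2, P3 be affinely independent points of the Euclidean plane ℝ² and let Δ = conv{P1,P2,P3}. A point m ∈ ℝ² is the geometric median of Δ (a global minimizer of Σ_Δ) if and only if the three mean distances from m to the three sides of the triangle are equal: Σ_{P1P2}(m)/‖P2−P1‖ = Σ_{P2P3}(m)/‖P3−P2‖ = Σ_{P3P1}(m)/‖P1−P3‖. -/

import Mathlib

open MeasureTheory

/-- The integral of the distance from `X` over the segment from `A` to `B`. -/
noncomputable def segInt (A B X : EuclideanSpace ℝ (Fin 2)) : ℝ :=
  ∫ t in (0:ℝ)..1, ‖A + t • (B - A) - X‖ * ‖B - A‖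

/-- `Σ_Ω(X) = ∫_{P ∈ Ω} ‖P − X‖ dP` with respect to Lebesgue (area) measure. -/
noncomputable def sigmaSet (Ω : Set (EuclideanSpace ℝ (Fin 2)))
    (X : EuclideanSpace ℝ (Fin 2)) : ℝ :=
  ∫ P in Ω, ‖P - X‖

section Gradient

variable {E : Type*} [NormedAddCommGroup E] [InnerProductSpace ℝ E]

/-- The unit vector pointing from `m` to `P` (zero when `P = m`). -/
noncomputable def unitDir (m P : E) : E := ‖P - m‖⁻¹ • (P - m)

lemma norm_unitDir_le (m P : E) : ‖unitDir m P‖ ≤ 1 := by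
  rw [unitDir, norm_smul, norm_inv, norm_norm]
  exact inv_mul_le_one

lemma measurable_unitDir [MeasurableSpace E] [BorelSpace E] [SecondCountableTopology E] (m : E) :
    Measurable (unitDir m) := by
  unfold unitDir
  fun_prop

lemma hasFDerivAt_norm_of_ne_zero {v : E} (hv : v ≠ 0) :
    HasFDerivAt (fun x : E => ‖x‖) (innerSL ℝ (‖v‖⁻¹ • v)) v := by
  have hsq : ‖v‖ ^ 2 ≠ 0 := by simpa using hv
  have := ((hasFDerivAt_id v).norm_sq).sqrt hsq
  simp only [id, Real.sqrt_sq (norm_nonneg _)] at this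
  refine this.congr_fderiv ?_
  ext w
  have : ‖v‖ ≠ 0 := by simpa using hv
  simp
  field_simp

lemma hasFDerivAt_norm_sub {P m : E} (h : P ≠ m) :
    HasFDerivAt (fun X => ‖P - X‖) (-innerSL ℝ (unitDir m P)) m := by
  refine ((hasFDerivAt_norm_of_ne_zero (sub_ne_zero.2 h)).comp m
    ((hasFDerivAt_id m).const_sub P)).congr_fderiv ?_
  ext w
  simp [unitDir]

lemma norm_sub_sub_inner_unitDir_le (m P X : E) :
    ‖P - m‖ - inner ℝ (unitDir m P) (X - m) ≤ ‖P - X‖ := by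
  have h1 : inner ℝ (unitDir m P) (P - m) = ‖P - m‖ := by
    rw [unitDir, real_inner_smul_left, real_inner_self_eq_norm_sq]
    rcases eq_or_ne ‖P - m‖ 0 with h | h
    · simp [h]
    · field_simp
  have h2 : inner ℝ (unitDir m P) (P - X) ≤ ‖P - X‖ :=
    (real_inner_le_norm _ _).trans
      (mul_le_of_le_one_left (norm_nonneg _) (norm_unitDir_le m P))
  rw [show X - m = (P - m) - (P - X) by abel, inner_sub_right, h1]
  linarith

lemma integral_inner_unitDir_line (A m : E) {w : E} (hw : w ≠ 0) (a b : ℝ) :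
    ∫ y in a..b, inner ℝ (unitDir m (A + y • w)) w = ‖A + b • w - m‖ - ‖A + a • w - m‖ := by
  have hS : {y : ℝ | A + y • w - m = 0}.Countable := by
    refine Set.Subsingleton.countable fun x hx y hy => ?_
    have : x • w = y • w := by
      simp only [Set.mem_ofPred_eq] at hx hy
      exact add_left_cancel (sub_left_injective (hx.trans hy.symm))
    exact smul_left_injective ℝ hw this
  have hder : ∀ y : ℝ, A + y • w - m ≠ 0 →
      HasDerivAt (fun y : ℝ => ‖A + y • w - m‖) (inner ℝ (unitDir m (A + y • w)) w) y := by
    intro y hy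
    have h1 : HasDerivAt (fun y : ℝ => A + y • w - m) w y := by
      simpa using (((hasDerivAt_id y).smul_const w).const_add A).sub_const m
    exact (hasFDerivAt_norm_of_ne_zero hy).comp_hasDerivAt y h1
  refine integral_eq_of_hasDerivAt_off_countable (fun y : ℝ => ‖A + y • w - m‖) _ hS
    (by fun_prop) (fun y hy => hder y hy.2) ?_
  refine (intervalIntegrable_const (c := ‖w‖)).mono_fun ?_ ?_
  · have hmeas : Measurable fun y : ℝ =>
        ‖A + y • w - m‖⁻¹ * (inner ℝ (A - m) w + y * inner ℝ w w) := by
      have : Continuous fun y : ℝ => ‖A + y • w - m‖ := by fun_prop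
      exact this.measurable.inv.mul (by fun_prop)
    refine hmeas.aestronglyMeasurable.congr (.of_forall fun y => ?_)
    beta_reduce
    rw [unitDir, real_inner_smul_left, show A + y • w - m = (A - m) + y • w by abel,
      inner_add_left, real_inner_smul_left]
  · refine Filter.Eventually.of_forall fun y => ?_
    rw [norm_norm]
    exact (norm_inner_le_norm _ _).trans
      (mul_le_of_le_one_left (norm_nonneg _) (norm_unitDir_le m _))

end Gradient

section Measure

variable {E : Type*} [NormedAddCommGroup E] [InnerProductSpace ℝ E] [FiniteDimensional ℝ E]
  [MeasurableSpace E] [BorelSpace E]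

lemma integrableOn_unitDir {μ : Measure E} [IsFiniteMeasureOnCompacts μ] {Ω : Set E}
    (hΩ : IsCompact Ω) (m : E) : IntegrableOn (unitDir m) Ω μ :=
  Measure.integrableOn_of_bounded (M := 1) hΩ.measure_lt_top.ne
    (measurable_unitDir m).aestronglyMeasurable (.of_forall (norm_unitDir_le m))

lemma isMinimizer_integral_norm_iff {μ : Measure E} [IsFiniteMeasureOnCompacts μ]
    [NullSingletonClass μ] {Ω : Set E} (hΩ : IsCompact Ω) (m : E) :
    (∀ X, ∫ P in Ω, ‖P - m‖ ∂μ ≤ ∫ P in Ω, ‖P - X‖ ∂μ) ↔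
      ∫ P in Ω, unitDir m P ∂μ = 0 := by
  have hint := integrableOn_unitDir (μ := μ) hΩ m
  have hF : ∀ X : E, IntegrableOn (fun P => ‖P - X‖) Ω μ := fun X =>
    (by fun_prop : Continuous fun P : E => ‖P - X‖).continuousOn.integrableOn_compact hΩ
  constructor
  · intro hmin
    have hfin : IsFiniteMeasure (μ.restrict Ω) :=
      isFiniteMeasure_restrict.2 hΩ.measure_lt_top.ne
    have hd := (hasFDerivAt_integral_of_dominated_loc_of_lip (μ := μ.restrict Ω) (𝕜 := ℝ)
      (F := fun X P => ‖P - X‖) (F' := fun P => -innerSL ℝ (unitDir m P)) (x₀ := m)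
      (bound := fun _ => 1) Filter.univ_mem
      (.of_forall fun X => (hF X).aestronglyMeasurable) (hF m)
      ((innerSL ℝ).continuous.comp_aestronglyMeasurable
        (measurable_unitDir m).aestronglyMeasurable).neg
      (.of_forall fun P => by
        simpa [funext (dist_eq_norm_sub P)] using LipschitzWith.dist_right P)
      (integrable_const _)
      ((Measure.ae_ne _ m).mono fun P hP => hasFDerivAt_norm_sub hP)).2
    have h0 := IsLocalMin.hasFDerivAt_eq_zero (.of_forall hmin) hd
    rw [integral_neg, neg_eq_zero, ContinuousLinearMap.integral_comp_comm _ hint] at h0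
    rwa [← norm_eq_zero, innerSL_apply_norm, norm_eq_zero] at h0
  · intro h0 X
    have h1 : ∫ P in Ω, (‖P - m‖ - inner ℝ (unitDir m P) (X - m)) ∂μ ≤ ∫ P in Ω, ‖P - X‖ ∂μ :=
      integral_mono ((hF m).sub (hint.inner_const _)) (hF X)
        fun P => norm_sub_sub_inner_unitDir_le m P X
    rw [integral_sub (hF m) (hint.inner_const _)] at h1
    have h2 : ∫ P in Ω, inner ℝ (unitDir m P) (X - m) ∂μ = 0 := by
      simp_rw [real_inner_comm (X - m)]
      rw [integral_inner hint, h0, inner_zero_right]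
    linarith

end Measure

section Triangle

lemma measurableSet_stdTriangle :
    MeasurableSet {p : ℝ × ℝ | 0 ≤ p.1 ∧ 0 ≤ p.2 ∧ p.1 + p.2 ≤ 1} := by
  measurability

lemma setIntegral_stdTriangle {f : ℝ × ℝ → ℝ}
    (hf : IntegrableOn f {p : ℝ × ℝ | 0 ≤ p.1 ∧ 0 ≤ p.2 ∧ p.1 + p.2 ≤ 1}) :
    ∫ p in {p : ℝ × ℝ | 0 ≤ p.1 ∧ 0 ≤ p.2 ∧ p.1 + p.2 ≤ 1}, f p =
      ∫ x in (0:ℝ)..1, ∫ y in (0:ℝ)..(1 - x), f (x, y) := by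
  rw [← integral_indicator measurableSet_stdTriangle, Measure.volume_eq_prod,
    integral_prod _ ((integrable_indicator_iff measurableSet_stdTriangle).2 hf),
    intervalIntegral.integral_of_le zero_le_one, ← integral_Icc_eq_integral_Ioc,
    ← integral_indicator measurableSet_Icc]
  congr 1 with x
  by_cases hx : x ∈ Set.Icc (0:ℝ) 1
  · rw [Set.indicator_of_mem hx, intervalIntegral.integral_of_le (by linarith [hx.2]),
      ← integral_Icc_eq_integral_Ioc, ← integral_indicator measurableSet_Icc]
    congr 1 with y
    simp only [Set.indicator_apply, Set.mem_ofPred_eq, Set.mem_Icc, hx.1, true_and, le_sub_iff_add_le']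
  · rw [Set.indicator_of_notMem hx]
    refine integral_eq_zero_of_ae (.of_forall fun y => ?_)
    have hxy : (x, y) ∉ {p : ℝ × ℝ | 0 ≤ p.1 ∧ 0 ≤ p.2 ∧ p.1 + p.2 ≤ 1} :=
      fun ⟨h1, h2, h3⟩ => hx ⟨h1, by simp only at h2 h3; linarith⟩
    exact Set.indicator_of_notMem hxy _

lemma convexHull_triple_eq_image {E : Type*} [AddCommGroup E] [Module ℝ E] (A B C : E) :
    convexHull ℝ {A, B, C} = (fun p : ℝ × ℝ => A + (p.1 • (B - A) + p.2 • (C - A))) ''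
      {p : ℝ × ℝ | 0 ≤ p.1 ∧ 0 ≤ p.2 ∧ p.1 + p.2 ≤ 1} := by
  apply Set.Subset.antisymm
  · refine convexHull_min ?_ ?_
    · rintro X (rfl | rfl | rfl)
      · exact ⟨(0, 0), by simp, by simp⟩
      · exact ⟨(1, 0), by simp, by simp⟩
      · exact ⟨(0, 1), by simp, by simp⟩
    · rintro _ ⟨p, ⟨hp1, hp2, hp3⟩, rfl⟩ _ ⟨q, ⟨hq1, hq2, hq3⟩, rfl⟩ a b ha hb hab
      refine ⟨a • p + b • q, ⟨?_, ?_, ?_⟩, ?_⟩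
      · simp only [Prod.fst_add, Prod.smul_fst, smul_eq_mul]; positivity
      · simp only [Prod.snd_add, Prod.smul_snd, smul_eq_mul]; positivity
      · simp only [Prod.fst_add, Prod.smul_fst, smul_eq_mul, Prod.snd_add, Prod.smul_snd]
        nlinarith
      · obtain rfl : b = 1 - a := by linarith
        simp only [Prod.fst_add, Prod.smul_fst, smul_eq_mul, Prod.snd_add, Prod.smul_snd]
        module
  · rintro _ ⟨⟨x, y⟩, ⟨hx, hy, hxy⟩, rfl⟩
    simp only at hx hy hxy
    have := (convex_convexHull ℝ {A, B, C}).sum_mem (t := Finset.univ)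
      (w := ![1 - x - y, x, y]) (z := ![A, B, C])
      (by intro i _; fin_cases i <;> simp <;> linarith)
      (by simp only [Fin.sum_univ_three, Matrix.cons_val]; ring)
      (by intro i _; apply subset_convexHull; fin_cases i <;> simp)
    convert! this using 1
    simp [Fin.sum_univ_three]
    module

lemma linearIndependent_sub_of_affineIndependent {V : Type*} [AddCommGroup V] [Module ℝ V]
    {A B C : V} (h : AffineIndependent ℝ ![A, B, C]) : LinearIndependent ℝ ![B - A, C - A] := by
  rw [affineIndependent_iff_linearIndependent_vsub ℝ _ (0 : Fin 3),
    ← linearIndependent_equiv (finSuccAboveEquiv (0 : Fin 3))] at h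
  convert! h using 1
  ext i
  fin_cases i <;> rfl

/-- Linear coordinates on the plane attached to two linearly independent vectors. -/
lemma exists_continuousLinearEquiv_prod {u w : EuclideanSpace ℝ (Fin 2)}
    (h : LinearIndependent ℝ ![u, w]) :
    ∃ e : (ℝ × ℝ) ≃L[ℝ] EuclideanSpace ℝ (Fin 2), ∀ p, e p = p.1 • u + p.2 • w := by
  let L : (ℝ × ℝ) →ₗ[ℝ] EuclideanSpace ℝ (Fin 2) :=
    (LinearMap.fst ℝ ℝ ℝ).smulRight u + (LinearMap.snd ℝ ℝ ℝ).smulRight w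
  have hL : Function.Injective L := by
    rw [injective_iff_map_eq_zero]
    rintro ⟨x, y⟩ hxy
    obtain ⟨rfl, rfl⟩ := LinearIndependent.pair_iff.1 h x y (by simpa [L] using hxy)
    rfl
  exact ⟨(LinearEquiv.ofInjectiveOfFinrankEq L hL (by simp)).toContinuousLinearEquiv,
    fun p => rfl⟩

lemma exists_setIntegral_triangle_eq {A B C : EuclideanSpace ℝ (Fin 2)}
    (h : LinearIndependent ℝ ![B - A, C - A]) :
    ∃ c : ℝ, 0 < c ∧ ∀ f : EuclideanSpace ℝ (Fin 2) → ℝ,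
      IntegrableOn f (convexHull ℝ {A, B, C}) →
      ∫ P in convexHull ℝ {A, B, C}, f P =
        c * ∫ x in (0:ℝ)..1, ∫ y in (0:ℝ)..(1 - x), f (A + x • (B - A) + y • (C - A)) := by
  obtain ⟨e, he⟩ := exists_continuousLinearEquiv_prod h
  set ν : Measure (EuclideanSpace ℝ (Fin 2)) := (volume : Measure (ℝ × ℝ)).map e with hν
  have hmap : ν = ν.addHaarScalarFactor volume • volume :=
    Measure.isAddLeftInvariant_eq_smul ν volume
  have hpos : 0 < ν.addHaarScalarFactor volume :=
    Measure.addHaarScalarFactor_pos_of_isAddHaarMeasure ν volume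
  set k := ν.addHaarScalarFactor volume
  let φ : ℝ × ℝ → EuclideanSpace ℝ (Fin 2) := fun p => A + e p
  have hφ : MeasurableEmbedding φ :=
    (measurableEmbedding_addLeft A).comp e.toHomeomorph.measurableEmbedding
  have hφmap : (volume : Measure (ℝ × ℝ)).map φ = k • volume := by
    have : φ = (fun P => A + P) ∘ e := rfl
    rw [this, ← Measure.map_map (measurable_const_add A) e.continuous.measurable, ← hν, hmap,
      Measure.map_smul, map_add_left_eq_self]
  have hpre : φ ⁻¹' convexHull ℝ {A, B, C} =
      {p : ℝ × ℝ | 0 ≤ p.1 ∧ 0 ≤ p.2 ∧ p.1 + p.2 ≤ 1} := by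
    rw [convexHull_triple_eq_image]
    simp_rw [← he]
    exact Set.preimage_image_eq _ hφ.injective
  refine ⟨(k : ℝ)⁻¹, by positivity, fun f hf => ?_⟩
  have hf' : IntegrableOn f (convexHull ℝ {A, B, C}) ((volume : Measure (ℝ × ℝ)).map φ) := by
    rw [hφmap, IntegrableOn, Measure.restrict_smul]
    exact hf.smul_measure_nnreal
  have key := hφ.setIntegral_map (μ := volume) f (convexHull ℝ {A, B, C})
  rw [hφ.integrableOn_map_iff, hpre] at hf'
  rw [hpre, setIntegral_stdTriangle (f := fun p => f (φ p)) hf', hφmap, Measure.restrict_smul,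
    integral_smul_nnreal_measure] at key
  have hk : (k : ℝ) ≠ 0 := by positivity
  rw [eq_inv_mul_iff_mul_eq₀ hk]
  simpa [φ, he, add_assoc, NNReal.smul_def] using key

lemma segInt_div_norm {A B : EuclideanSpace ℝ (Fin 2)} (X : EuclideanSpace ℝ (Fin 2))
    (h : A ≠ B) : segInt A B X / ‖B - A‖ = ∫ t in (0:ℝ)..1, ‖A + t • (B - A) - X‖ := by
  have : ‖B - A‖ ≠ 0 := norm_ne_zero_iff.2 (sub_ne_zero.2 h.symm)
  rw [segInt, intervalIntegral.integral_mul_const, mul_div_cancel_right₀ _ this]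

/-- Along a side of a triangle, the derivative of the total distance is a positive multiple of the
difference of the mean distances to the two other sides. -/
lemma exists_inner_integral_unitDir_eq {A B C : EuclideanSpace ℝ (Fin 2)}
    (h : AffineIndependent ℝ ![A, B, C]) (m : EuclideanSpace ℝ (Fin 2)) :
    ∃ c : ℝ, 0 < c ∧ inner ℝ (C - A) (∫ P in convexHull ℝ {A, B, C}, unitDir m P) =
      c * (segInt B C m / ‖C - B‖ - segInt A B m / ‖B - A‖) := by
  have hAB : A ≠ B := h.injective.ne (show (0 : Fin 3) ≠ 1 by decide)
  have hBC : B ≠ C := h.injective.ne (show (1 : Fin 3) ≠ 2 by decide)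
  have hAC : A ≠ C := h.injective.ne (show (0 : Fin 3) ≠ 2 by decide)
  have hint := integrableOn_unitDir (μ := volume)
    (Set.Finite.isCompact_convexHull ℝ (s := {A, B, C}) (by simp)) m
  obtain ⟨c, hc, hci⟩ :=
    exists_setIntegral_triangle_eq (linearIndependent_sub_of_affineIndependent h)
  refine ⟨c, hc, ?_⟩
  rw [← integral_inner hint]
  simp_rw [real_inner_comm _ (C - A)]
  rw [hci _ (hint.inner_const _), segInt_div_norm m hBC, segInt_div_norm m hAB]
  simp_rw [integral_inner_unitDir_line _ m (sub_ne_zero.2 hAC.symm)]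
  rw [intervalIntegral.integral_sub
    (by apply Continuous.intervalIntegrable; fun_prop)
    (by apply Continuous.intervalIntegrable; fun_prop)]
  have hrev := intervalIntegral.integral_comp_sub_left (a := 0) (b := 1)
    (fun t : ℝ => ‖B + t • (C - B) - m‖) 1
  simp only [sub_self, sub_zero] at hrev
  rw [← hrev]
  congr 3
  · ext x
    congr 2
    module
  · simp

end Triangle

theorem stmt_1 (P1 P2 P3 m : EuclideanSpace ℝ (Fin 2))
    (h : AffineIndependent ℝ ![P1, P2, P3]) :
    (∀ X, sigmaSet (convexHull ℝ {P1, P2, P3}) m ≤ sigmaSet (convexHull ℝ {P1, P2, P3}) X) ↔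
      (segInt P1 P2 m / ‖P2 - P1‖ = segInt P2 P3 m / ‖P3 - P2‖ ∧
        segInt P2 P3 m / ‖P3 - P2‖ = segInt P3 P1 m / ‖P1 - P3‖) := by
  have h' : AffineIndependent ℝ ![P2, P3, P1] := by
    convert! h.comp_embedding (finRotate 3).toEmbedding using 1
    ext i
    fin_cases i <;> rfl
  have hset : ({P2, P3, P1} : Set (EuclideanSpace ℝ (Fin 2))) = {P1, P2, P3} := by
    ext; simp; tauto
  obtain ⟨c, hc, h1⟩ := exists_inner_integral_unitDir_eq h m
  obtain ⟨c', hc', h2⟩ := exists_inner_integral_unitDir_eq h' m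
  rw [hset] at h2
  refine (isMinimizer_integral_norm_iff
    (Set.Finite.isCompact_convexHull ℝ (s := {P1, P2, P3}) (by simp)) m).trans ?_
  set G := ∫ P in convexHull ℝ {P1, P2, P3}, unitDir m P
  constructor
  · intro hG
    rw [hG, inner_zero_right, eq_comm, mul_eq_zero_iff_left hc.ne', sub_eq_zero] at h1
    rw [hG, inner_zero_right, eq_comm, mul_eq_zero_iff_left hc'.ne', sub_eq_zero] at h2
    exact ⟨h1.symm, h2.symm⟩
  · rintro ⟨e1, e2⟩
    rw [e1, sub_self, mul_zero] at h1
    rw [e2, sub_self, mul_zero, ← neg_sub P2 P1, inner_neg_left, neg_eq_zero] at h2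
    obtain ⟨e, he⟩ :=
      exists_continuousLinearEquiv_prod (linearIndependent_sub_of_affineIndependent h)
    obtain ⟨p, hp⟩ := e.surjective G
    rw [← inner_self_eq_zero (𝕜 := ℝ)]
    nth_rewrite 1 [← hp]
    rw [he, inner_add_left, real_inner_smul_left, real_inner_smul_left, h1, h2]
    simp
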